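/- arXiv:1207.2652 — 2 statements merged into one kernel-verified Lean document; each statement's English description precedes it below -/
import Mathlib

section
/- Let M ⊆ ℝ^d be measurable and L : M × M^{m×d} → [0,∞] be ru-usc. Assume that for a.e. x ∈ M the effective domain dom L(x,·) is star shaped with respect to 0 in the strong sense: t · closure(dom L(x,·)) ⊆ dom L(x,·) for all t ∈ (0,1). Then for a.e. x ∈ M and all ξ ∈ closure(dom L(x,·)), the limit lim_{t→1⁻} L(x,tξ) exists and equals L̂(x,ξ) := liminf_{t→1⁻} L(x,tξ); moreover L̂ is ru-usc. -/
open Filter Set Topology MeasureTheory Pointwise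

/-- Matrices are measurably a function space. -/
instance matrixMeasurableSpace {m d : ℕ} : MeasurableSpace (Matrix (Fin m) (Fin d) ℝ) :=
  inferInstanceAs (MeasurableSpace ((Fin m) → (Fin d) → ℝ))

/-- `Δ^a_L(t)`: the essential supremum over `x ∈ M` of
`sup_{ξ ∈ dom L(x,·)} (L(x,tξ) − L(x,ξ))/(a(x) + L(x,ξ))`, computed in `EReal`. -/
noncomputable def deltaInt {d m : ℕ} (M : Set (Fin d → ℝ))
    (L : (Fin d → ℝ) → Matrix (Fin m) (Fin d) ℝ → ENNReal)
    (a : (Fin d → ℝ) → ENNReal) (t : ℝ) : EReal :=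
  essSup (fun x =>
      ⨆ ξ ∈ {ξ : Matrix (Fin m) (Fin d) ℝ | L x ξ < ⊤},
        (((L x (t • ξ)) : EReal) - ((L x ξ) : EReal)) /
          (((a x) : EReal) + ((L x ξ) : EReal)))
    (volume.restrict M)

/-- `L̂(x,ξ) := liminf_{t→1⁻} L(x, tξ)`. -/
noncomputable def hatL {d m : ℕ}
    (L : (Fin d → ℝ) → Matrix (Fin m) (Fin d) ℝ → ENNReal)
    (x : Fin d → ℝ) (ξ : Matrix (Fin m) (Fin d) ℝ) : ENNReal :=
  Filter.liminf (fun t : ℝ => L x (t • ξ)) (nhdsWithin 1 (Set.Iio 1))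

/-- Lusin: an analytic set contains compact sets of measure arbitrarily close to its own. -/
theorem MeasureTheory.AnalyticSet.exists_isCompact_le_measure {X : Type*} [TopologicalSpace X]
    [MeasurableSpace X] {A : Set X} (hA : AnalyticSet A) (μ : Measure X) [μ.OuterRegular]
    {c : ENNReal} (hc : c < μ A) : ∃ K ⊆ A, IsCompact K ∧ c ≤ μ K := by
  rw [AnalyticSet] at hA
  rcases hA with rfl | ⟨f, hf, rfl⟩
  · simp at hc
  let C : ℕ → (ℕ → ℕ) → Set (ℕ → ℕ) := fun n b => {y | ∀ i < n, y i ≤ b i}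
  have step (n : ℕ) (b : ℕ → ℕ) (h : c < μ (f '' C n b)) :
      ∃ k, c < μ (f '' (C n b ∩ {y | y n ≤ k})) := by
    have hmono : Monotone fun k : ℕ => f '' (C n b ∩ {y | y n ≤ k}) := fun k l hkl =>
      image_mono (inter_subset_inter_right _ fun y hy => le_trans hy hkl)
    have hU : ⋃ k : ℕ, f '' (C n b ∩ {y | y n ≤ k}) = f '' C n b := by
      rw [← image_iUnion, ← inter_iUnion]
      congr 1
      refine inter_eq_left.2 fun y _ => mem_iUnion.2 ⟨y n, le_refl (y n)⟩
    rw [← hU, hmono.measure_iUnion] at h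
    exact lt_iSup_iff.1 h
  choose! k hk using step
  let B : ℕ → ℕ → ℕ := fun n => Nat.rec (fun _ => 0) (fun n b => Function.update b n (k n b)) n
  have hB_succ (n : ℕ) : B (n + 1) = Function.update (B n) n (k n (B n)) := rfl
  have hB_stable (i n : ℕ) (hin : i < n) : B n i = B (i + 1) i := by
    induction n, hin using Nat.le_induction with
    | base => rfl
    | succ n hn ih => rw [hB_succ, Function.update_of_ne (by lia), ih]
  let b : ℕ → ℕ := fun i => B (i + 1) i
  have hCB (n : ℕ) : C n (B n) = C n b := by
    ext y
    exact forall₂_congr fun i hi => by rw [hB_stable i n hi]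
  have hCb (n : ℕ) : c < μ (f '' C n b) := by
    induction n with
    | zero => simpa [C] using hc
    | succ n ih =>
      rw [← hCB] at ih
      refine (hk n _ ih).trans_le (measure_mono (image_mono ?_))
      rintro y ⟨hy, hyn⟩ i hi
      rw [hCB] at hy
      rcases Nat.lt_succ_iff_lt_or_eq.1 hi with h | rfl
      · exact hy i h
      · simpa [b, hB_succ] using hyn
  let K : Set (ℕ → ℕ) := univ.pi fun i => Iic (b i)
  have hK : IsCompact K := isCompact_univ_pi fun i => (finite_Iic (b i)).isCompact
  refine ⟨f '' K, image_subset_range _ _, hK.image hf, ?_⟩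
  rw [(f '' K).measure_eq_iInf_isOpen]
  refine le_iInf₂ fun U hKU => le_iInf fun hU => ?_
  suffices ∃ n, C n b ⊆ f ⁻¹' U by
    obtain ⟨n, hn⟩ := this
    exact (hCb n).le.trans (measure_mono (image_subset_iff.2 hn))
  by_contra! hcon
  choose y hyC hyU using fun n => not_subset.1 (hcon n)
  obtain ⟨z, hz, φ, hφ, hlim⟩ := hK.tendsto_subseq (x := fun n i => min (y n i) (b i))
    fun n i _ => mem_Iic.2 (min_le_right _ _)
  have hylim : Tendsto (y ∘ φ) atTop (𝓝 z) := by
    rw [tendsto_pi_nhds] at hlim ⊢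
    intro i
    refine (hlim i).congr' ?_
    filter_upwards [eventually_gt_atTop i] with n hn
    exact min_eq_left (hyC (φ n) i (hn.trans_le (hφ.id_le n)))
  obtain ⟨n, hn⟩ := (hylim.eventually
    ((hU.preimage hf).mem_nhds (hKU (mem_image_of_mem f hz)))).exists
  exact hyU _ hn

/-- Lusin: analytic sets are universally measurable. -/
theorem MeasureTheory.AnalyticSet.nullMeasurableSet {X : Type*} [TopologicalSpace X]
    [PolishSpace X] [MeasurableSpace X] [BorelSpace X] {A : Set X} (hA : AnalyticSet A)
    (μ : Measure X) [SFinite μ] : NullMeasurableSet A μ := by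
  obtain ⟨ν, hν, hμν, -⟩ := exists_isFiniteMeasure_absolutelyContinuous μ
  refine NullMeasurableSet.mono_ac ?_ hμν
  let := TopologicalSpace.upgradeIsCompletelyMetrizable X
  rcases eq_or_ne (ν A) 0 with h0 | h0
  · exact NullMeasurableSet.of_null h0
  obtain ⟨c, -, hcA, hc⟩ := exists_seq_strictMono_tendsto' (pos_iff_ne_zero.2 h0)
  choose K hKA hK hcK using fun n => hA.exists_isCompact_le_measure ν (hcA n).2
  have hKm : MeasurableSet (⋃ n, K n) := MeasurableSet.iUnion fun n => (hK n).measurableSet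
  have hle : ν A ≤ ν (⋃ n, K n) :=
    le_of_tendsto' hc fun n => (hcK n).trans (measure_mono (subset_iUnion K n))
  exact hKm.nullMeasurableSet.congr
    (ae_eq_of_subset_of_measure_ge (iUnion_subset hKA) hle hKm.nullMeasurableSet
      (measure_ne_top ν A))

/-- Fubini for null sets which are projections of Borel sets, relative to an arbitrary set `S`. -/
theorem ae_ae_forall_notMem_of_measurableSet {X T E : Type*}
    [TopologicalSpace X] [PolishSpace X] [MeasurableSpace X] [BorelSpace X]
    [TopologicalSpace T] [PolishSpace T] [MeasurableSpace T] [BorelSpace T]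
    [TopologicalSpace E] [PolishSpace E] [MeasurableSpace E] [BorelSpace E]
    (μ : Measure X) [SFinite μ] (ν : Measure T) [SFinite ν] (S : Set X)
    {R : Set ((X × T) × E)} (hR : MeasurableSet R)
    (h : ∀ᵐ t ∂ν, ∀ᵐ x ∂μ, x ∈ S → ∀ e, ((x, t), e) ∉ R) :
    ∀ᵐ x ∂μ.restrict S, ∀ᵐ t ∂ν, ∀ e, ((x, t), e) ∉ R := by
  have hA : AnalyticSet (Prod.fst '' R) := hR.analyticSet.image_of_continuous continuous_fst
  have hsec (t : T) : AnalyticSet ((fun x => (x, t)) ⁻¹' (Prod.fst '' R)) :=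
    hA.preimage (by fun_prop)
  obtain ⟨D, hDR, hD, hDA⟩ :=
    (hA.nullMeasurableSet ((μ.restrict S).prod ν)).exists_measurable_subset_ae_eq
  have hD0 : (μ.restrict S).prod ν D = 0 := by
    rw [Measure.prod_apply_symm hD, lintegral_eq_zero_iff (measurable_measure_prodMk_right hD)]
    filter_upwards [h] with t ht
    refine measure_mono_null (preimage_mono hDR) ?_
    rw [Measure.restrict_apply₀ ((hsec t).nullMeasurableSet _)]
    refine measure_mono_null ?_ ht
    rintro x ⟨⟨⟨p, e⟩, hpR, rfl⟩, hxS⟩ hx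
    exact hx hxS e hpR
  rw [measure_congr hDA] at hD0
  filter_upwards [Measure.measure_ae_null_of_prod_null hD0] with x hx
  refine measure_mono_null (fun t ht => ?_) hx
  simp only [mem_compl_iff, mem_ofPred_eq, not_forall, not_not] at ht
  obtain ⟨e, he⟩ := ht
  exact ⟨_, he, rfl⟩

/-- A nonnegative function which is integrable on compact subsets is finite almost everywhere, in
the sense that its finiteness set (possibly nonmeasurable) carries the whole measure. -/
theorem ae_restrict_of_forall_ae_restrict_le_natCast {X : Type*} [TopologicalSpace X] [T2Space X]
    [MeasurableSpace X] [BorelSpace X] {μ : Measure X} [SFinite μ] [μ.InnerRegular]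
    {M : Set X} (hM : MeasurableSet M) {a : X → ENNReal}
    (ha : ∀ K : Set X, IsCompact K → K ⊆ M → ∫⁻ x in K, a x ∂μ < ⊤) {p : X → Prop}
    (hp : ∀ j : ℕ, ∀ᵐ x ∂μ.restrict {x ∈ M | a x ≤ j}, p x) : ∀ᵐ x ∂μ.restrict M, p x := by
  set S : Set X := ⋃ j : ℕ, {x ∈ M | a x ≤ j}
  set T : Set X := toMeasurable μ S
  have hT : ∀ᵐ x ∂μ.restrict T, p x := by
    rw [Measure.restrict_toMeasurable_of_sFinite]
    exact (ae_restrict_iUnion_iff _ _).2 hp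
  have hMT : μ (M \ T) = 0 := by
    by_contra h0
    obtain ⟨K, hKsub, hK, hKpos⟩ := (hM.diff (measurableSet_toMeasurable μ S)).exists_lt_isCompact
      (pos_iff_ne_zero.2 h0)
    refine (ha K hK (hKsub.trans sdiff_subset)).ne ?_
    have htop : EqOn a (fun _ => ⊤) K := fun x hx => by
      by_contra hax
      obtain ⟨j, hj⟩ := ENNReal.exists_nat_gt hax
      exact (hKsub hx).2 (subset_toMeasurable μ S (mem_iUnion.2 ⟨j, (hKsub hx).1, hj.le⟩))
    rw [setLIntegral_congr_fun hK.measurableSet htop, setLIntegral_const,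
      ENNReal.top_mul hKpos.ne']
  refine ae_restrict_of_ae_restrict_of_subset (t := T ∪ M \ T) (by simp) ?_
  rw [ae_restrict_union_iff]
  refine ⟨hT, ?_⟩
  rw [Measure.restrict_eq_zero.2 hMT]
  simp

/-- A function which is almost increasing, up to factors close to `1`, has a left limit at `1`. -/
theorem tendsto_liminf_of_le_mul {F : ℝ → ENNReal} {c : ℕ → NNReal} (hc : Tendsto c atTop (𝓝 1))
    (h : ∀ k, ∃ δ < (1 : ℝ), ∀ r s, δ < r → r < s → s < 1 → F r ≤ c k * F s) :
    Tendsto F (𝓝[<] 1) (𝓝 (liminf F (𝓝[<] 1))) := by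
  refine tendsto_of_le_liminf_of_limsup_le le_rfl ?_
  have hle (k : ℕ) : limsup F (𝓝[<] 1) ≤ c k * liminf F (𝓝[<] 1) := by
    obtain ⟨δ, hδ, hF⟩ := h k
    refine limsup_le_of_le (h := ?_)
    filter_upwards [Ioo_mem_nhdsLT hδ] with r hr
    rw [← ENNReal.liminf_const_mul_of_ne_top ENNReal.coe_ne_top]
    refine le_liminf_of_le (h := ?_)
    filter_upwards [Ioo_mem_nhdsLT hr.2] with s hs
    exact hF r s hr.1 hs.1 hs.2
  have hlim : Tendsto (fun k => (c k : ENNReal) * liminf F (𝓝[<] 1)) atTop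
      (𝓝 ((1 : NNReal) * liminf F (𝓝[<] 1))) :=
    ENNReal.Tendsto.mul_const (ENNReal.tendsto_coe.2 hc) (Or.inl (by simp))
  rw [ENNReal.coe_one, one_mul] at hlim
  exact ge_of_tendsto' hlim hle

theorem exists_mem_Ioo_and_div_of_ae {δ t : ℝ} (hδ : 0 ≤ δ) (ht : t ∈ Ioo δ 1) {p : ℝ → Prop}
    (hp : ∀ᵐ s ∂volume.restrict (Ioo δ 1), p s) : ∃ s ∈ Ioo t 1, p s ∧ p (t / s) := by
  have ht0 : 0 < t := hδ.trans_lt ht.1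
  have hN : volume (Ioo δ 1 ∩ {s | ¬ p s}) = 0 := by
    rw [ae_restrict_iff' measurableSet_Ioo] at hp
    refine measure_mono_null ?_ hp
    rintro s ⟨hs, hps⟩ h
    exact hps (h hs)
  have hN' : volume ((fun s => t / s) '' (Ioo δ 1 ∩ {s | ¬ p s})) = 0 := by
    refine addHaar_image_eq_zero_of_differentiableOn_of_addHaar_eq_zero _ (fun s hs => ?_) hN
    have : s ≠ 0 := (hδ.trans_lt hs.1.1).ne'
    exact DifferentiableAt.differentiableWithinAt (by fun_prop (disch := assumption))
  by_contra! hcon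
  have hsub : Ioo t 1 ⊆ (Ioo δ 1 ∩ {s | ¬ p s}) ∪
      ((fun s => t / s) '' (Ioo δ 1 ∩ {s | ¬ p s})) := by
    intro s hs
    have hs0 : 0 < s := ht0.trans hs.1
    by_cases hps : p s
    · refine Or.inr ⟨t / s, ⟨⟨ht.1.trans ?_, ?_⟩, hcon s hs hps⟩, by field_simp⟩
      · rw [lt_div_iff₀ hs0]; nlinarith [hs.2]
      · rw [div_lt_one hs0]; exact hs.1
    · exact Or.inl ⟨⟨ht.1.trans hs.1, hs.2⟩, hps⟩
  have h0 := measure_mono_null hsub (measure_union_null hN hN')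
  rw [Real.volume_Ioo, ENNReal.ofReal_eq_zero] at h0
  linarith [ht.2]

theorem EReal.sub_div_add_le_coe_iff {A B α : ENNReal} {ε : NNReal} (hα : α ≠ 0) (hα' : α ≠ ⊤)
    (hB : B ≠ ⊤) :
    ((A : EReal) - B) / (α + B) ≤ ((ε : ENNReal) : EReal) ↔ A ≤ B + ε * (α + B) := by
  have hpos : (0 : EReal) < (α : EReal) + B := by
    rw [← EReal.coe_ennreal_add, EReal.coe_ennreal_pos]
    exact (pos_iff_ne_zero.2 hα).trans_le le_self_add
  have htop : (α : EReal) + B ≠ ⊤ := by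
    rw [← EReal.coe_ennreal_add, Ne, EReal.coe_ennreal_eq_top_iff]
    exact ENNReal.add_ne_top.2 ⟨hα', hB⟩
  rw [EReal.div_le_iff_le_mul hpos htop, EReal.sub_le_iff_le_add (Or.inl (by simp))
    (Or.inl (by simpa using hB)), ← EReal.coe_ennreal_add, ← EReal.coe_ennreal_mul,
    ← EReal.coe_ennreal_add, EReal.coe_ennreal_le_coe_ennreal_iff, add_comm B,
    mul_comm (ε : ENNReal)]

theorem le_add_mul_iff_add_le_mul_add {A B α : ENNReal} {ε : NNReal} (hα : α ≠ ⊤) :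
    A ≤ B + ε * (α + B) ↔ A + α ≤ ((1 + ε : NNReal) : ENNReal) * (B + α) := by
  rw [← ENNReal.add_le_add_iff_right hα]
  apply iff_of_eq
  push_cast
  ring_nf

theorem ae_le_add_mul_of_deltaInt_lt {d m : ℕ} {M : Set (Fin d → ℝ)} (hM : MeasurableSet M)
    {L : (Fin d → ℝ) → Matrix (Fin m) (Fin d) ℝ → ENNReal} {a : (Fin d → ℝ) → ENNReal}
    (hapos : ∀ x ∈ M, 0 < a x) {t : ℝ} {ε : NNReal}
    (h : deltaInt M L a t < ((ε : ENNReal) : EReal)) :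
    ∀ᵐ x ∂volume.restrict M, a x ≠ ⊤ → ∀ ξ, L x ξ < ⊤ →
      L x (t • ξ) ≤ L x ξ + ε * (a x + L x ξ) := by
  filter_upwards [ae_lt_of_essSup_lt h, ae_restrict_mem hM] with x hx hxM hax ξ hξ
  rw [← EReal.sub_div_add_le_coe_iff (hapos x hxM).ne' hax hξ.ne]
  exact (le_iSup₂ (f := fun ξ (_ : ξ ∈ {ξ | L x ξ < ⊤}) =>
    (((L x (t • ξ)) : EReal) - ((L x ξ) : EReal)) / (((a x) : EReal) + ((L x ξ) : EReal)))
    ξ hξ).trans hx.le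

theorem hatL_smul_le {d m : ℕ} {L : (Fin d → ℝ) → Matrix (Fin m) (Fin d) ℝ → ENNReal}
    {x : Fin d → ℝ} {α : ENNReal} {t : ℝ} {ε : NNReal}
    (h : ∀ ξ, L x ξ < ⊤ → L x (t • ξ) ≤ L x ξ + ε * (α + L x ξ)) (ξ : Matrix (Fin m) (Fin d) ℝ)
    (hξ : ∀ᶠ s in 𝓝[<] (1 : ℝ), L x (s • ξ) < ⊤) :
    hatL L x (t • ξ) ≤ hatL L x ξ + ε * (α + hatL L x ξ) := by
  let φ : ENNReal → ENNReal := fun y => y + ε * (α + y)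
  have hφ : Monotone φ := fun y z hyz => by dsimp only [φ]; gcongr
  have hφc : Continuous φ :=
    continuous_id.add ((ENNReal.continuous_const_mul ENNReal.coe_ne_top).comp
      (continuous_const.add continuous_id))
  change liminf _ _ ≤ φ (liminf _ _)
  rw [hφ.map_liminf_of_continuousAt _ hφc.continuousAt]
  refine liminf_le_liminf ?_
  filter_upwards [hξ] with s hs
  rw [smul_comm]
  exact h _ hs

/-- (Lemma `ruuscLimit`.) If `L` is ru-usc and for a.e. `x ∈ M` its effective domain is
star shaped w.r.t. `0` in the strong sense `t·cl(dom L(x,·)) ⊆ dom L(x,·)`, then for a.e.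
`x ∈ M` and every `ξ ∈ cl(dom L(x,·))` the limit `lim_{t→1⁻} L(x,tξ)` exists and equals
`L̂(x,ξ)`; moreover `L̂` is ru-usc. -/
theorem stmt12 {d m : ℕ} (M : Set (Fin d → ℝ)) (hM : MeasurableSet M)
    (L : (Fin d → ℝ) → Matrix (Fin m) (Fin d) ℝ → ENNReal)
    (hmeas : Measurable (Function.uncurry L))
    (a : (Fin d → ℝ) → ENNReal) (hapos : ∀ x ∈ M, 0 < a x)
    (haloc : ∀ K : Set (Fin d → ℝ), IsCompact K → K ⊆ M → ∫⁻ x in K, a x < ⊤)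
    (hru : Filter.limsup (fun t : ℝ => deltaInt M L a t) (nhdsWithin 1 (Set.Iio 1)) ≤ 0)
    (hstar : ∀ᵐ x ∂(volume.restrict M), ∀ t ∈ Set.Ioo (0 : ℝ) 1,
      t • closure {ξ : Matrix (Fin m) (Fin d) ℝ | L x ξ < ⊤} ⊆ {ξ | L x ξ < ⊤}) :
    (∀ᵐ x ∂(volume.restrict M),
      ∀ ξ ∈ closure {ξ : Matrix (Fin m) (Fin d) ℝ | L x ξ < ⊤},
        Filter.Tendsto (fun t : ℝ => L x (t • ξ)) (nhdsWithin 1 (Set.Iio 1))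
          (nhds (hatL L x ξ))) ∧
    Filter.limsup (fun t : ℝ => deltaInt M (hatL L) a t) (nhdsWithin 1 (Set.Iio 1)) ≤ 0 := by
  have hev (ε : NNReal) (hε : 0 < ε) :
      ∀ᶠ t in 𝓝[<] (1 : ℝ), deltaInt M L a t < ((ε : ENNReal) : EReal) :=
    eventually_lt_of_limsup_lt (hru.trans_lt (by simpa using hε))
  constructor
  · let ε : ℕ → NNReal := fun k => 1 / ((k : NNReal) + 1)
    have hε (k : ℕ) : 0 < ε k := by positivity
    have hc : Tendsto (fun k => (1 + ε k) * (1 + ε k)) atTop (𝓝 1) := by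
      have h1 : Tendsto (fun k => 1 + ε k) atTop (𝓝 (1 + 0)) :=
        tendsto_const_nhds.add tendsto_one_div_add_atTop_nhds_zero_nat
      simpa using h1.mul h1
    have hδ (k : ℕ) : ∃ δ : ℝ, 0 ≤ δ ∧ δ < 1 ∧
        ∀ t ∈ Ioo δ 1, deltaInt M L a t < ((ε k : ENNReal) : EReal) := by
      obtain ⟨l, hl, hsub⟩ := mem_nhdsLT_iff_exists_Ioo_subset.1 (hev (ε k) (hε k))
      exact ⟨max l 0, le_max_right _ _, max_lt hl one_pos,
        fun t ht => hsub ⟨(le_max_left _ _).trans_lt ht.1, ht.2⟩⟩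
    choose δ hδ0 hδ1 hδ using hδ
    have : PolishSpace (Matrix (Fin m) (Fin d) ℝ) :=
      inferInstanceAs (PolishSpace (Fin m → Fin d → ℝ))
    have : BorelSpace (Matrix (Fin m) (Fin d) ℝ) :=
      inferInstanceAs (BorelSpace (Fin m → Fin d → ℝ))
    have hgood (j k : ℕ) : ∀ᵐ x ∂volume.restrict {x ∈ M | a x ≤ j},
        ∀ᵐ t ∂volume.restrict (Ioo (δ k) 1), ∀ ξ, L x ξ < ⊤ →
          L x (t • ξ) ≤ L x ξ + ε k * (j + L x ξ) := by
      let R : Set (((Fin d → ℝ) × ℝ) × Matrix (Fin m) (Fin d) ℝ) :=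
        {p | L p.1.1 p.2 < ⊤ ∧
          L p.1.1 p.2 + ε k * (j + L p.1.1 p.2) < L p.1.1 (p.1.2 • p.2)}
      have hL : Measurable fun p : ((Fin d → ℝ) × ℝ) × Matrix (Fin m) (Fin d) ℝ =>
          L p.1.1 p.2 := hmeas.comp (by fun_prop : Measurable fun p :
            ((Fin d → ℝ) × ℝ) × Matrix (Fin m) (Fin d) ℝ => (p.1.1, p.2))
      have hLt : Measurable fun p : ((Fin d → ℝ) × ℝ) × Matrix (Fin m) (Fin d) ℝ =>
          L p.1.1 (p.1.2 • p.2) := hmeas.comp (by fun_prop : Continuous fun p :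
            ((Fin d → ℝ) × ℝ) × Matrix (Fin m) (Fin d) ℝ => (p.1.1, p.1.2 • p.2)).measurable
      have hR : MeasurableSet R :=
        (measurableSet_lt hL measurable_const).inter (measurableSet_lt (by fun_prop) hLt)
      have hRae := ae_ae_forall_notMem_of_measurableSet volume (volume.restrict (Ioo (δ k) 1))
        {x ∈ M | a x ≤ j} hR (by
          filter_upwards [ae_restrict_mem measurableSet_Ioo] with t ht
          have hae := ae_le_add_mul_of_deltaInt_lt hM hapos (hδ k t ht)
          rw [ae_restrict_iff' hM] at hae
          filter_upwards [hae] with x hx hxS ξ hξ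
          refine hξ.2.not_ge ((hx hxS.1 (hxS.2.trans_lt (by simp)).ne ξ hξ.1).trans ?_)
          gcongr
          exact hxS.2)
      filter_upwards [hRae] with x hx
      filter_upwards [hx] with t ht ξ hξ
      by_contra! hcon
      exact ht ξ ⟨hξ, hcon⟩
    refine ae_restrict_of_forall_ae_restrict_le_natCast hM haloc fun j => ?_
    filter_upwards [ae_all_iff.2 (hgood j),
      ae_restrict_of_ae_restrict_of_subset (sep_subset M _) hstar] with x hx hxstar ξ hξ
    have hmem {η : Matrix (Fin m) (Fin d) ℝ} (hη : η ∈ closure {ξ | L x ξ < ⊤}) {t : ℝ}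
        (ht : t ∈ Ioo (0 : ℝ) 1) : L x (t • η) < ⊤ := hxstar t ht (smul_mem_smul_set hη)
    have hF := tendsto_liminf_of_le_mul (F := fun r => L x (r • ξ) + j) hc fun k => by
      refine ⟨δ k, hδ1 k, fun r s hr hrs hs => ?_⟩
      have hr0 : 0 < r := (hδ0 k).trans_lt hr
      have hs0 : 0 < s := hr0.trans hrs
      have hrs' : r / s ∈ Ioo (δ k) 1 :=
        ⟨hr.trans (by rw [lt_div_iff₀ hs0]; nlinarith), (div_lt_one hs0).2 hrs⟩
      obtain ⟨u, hu, hpu, hpu'⟩ := exists_mem_Ioo_and_div_of_ae (hδ0 k) hrs' (hx k)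
      have hu0 : 0 < u := (div_pos hr0 hs0).trans hu.1
      have hη : L x (s • ξ) < ⊤ := hmem hξ ⟨hs0, hs⟩
      have hη' : L x ((r / s / u) • s • ξ) < ⊤ :=
        hmem (subset_closure hη) ⟨div_pos (div_pos hr0 hs0) hu0, (div_lt_one hu0).2 hu.1⟩
      have h1 := (le_add_mul_iff_add_le_mul_add (ENNReal.natCast_ne_top j)).1 (hpu' _ hη)
      have h2 := (le_add_mul_iff_add_le_mul_add (ENNReal.natCast_ne_top j)).1 (hpu _ hη')
      have hr_eq : u • (r / s / u) • s • ξ = r • ξ := by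
        rw [smul_smul, smul_smul]
        congr 1
        field_simp
      rw [hr_eq] at h2
      refine h2.trans ?_
      rw [ENNReal.coe_mul, mul_assoc]
      gcongr
    have hsub := ENNReal.Tendsto.sub hF (tendsto_const_nhds (x := (j : ENNReal)))
      (Or.inr (ENNReal.natCast_ne_top j))
    simp only [ENNReal.add_sub_cancel_right (ENNReal.natCast_ne_top j)] at hsub
    rw [hatL, hsub.liminf_eq]
    exact hsub
  · refine le_of_forall_gt_imp_ge_of_dense fun c hc => ?_
    obtain ⟨r, hr0, hrc⟩ := EReal.lt_iff_exists_real_btwn.1 hc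
    lift r to NNReal using by exact_mod_cast hr0.le
    refine le_trans (limsup_le_of_le (h := ?_)) hrc.le
    filter_upwards [hev r (by exact_mod_cast hr0)] with t ht
    refine essSup_le_of_ae_le _ ?_
    filter_upwards [ae_le_add_mul_of_deltaInt_lt hM hapos ht, hstar, ae_restrict_mem hM]
      with x hx hxstar hxM
    refine iSup₂_le fun ξ hξ => ?_
    by_cases hax : a x = ⊤
    · rw [← EReal.coe_ennreal_add, hax, top_add, EReal.coe_ennreal_top, EReal.div_top]
      exact hr0.le
    have hξ' : hatL L x ξ < ⊤ := hξ
    refine (EReal.sub_div_add_le_coe_iff (hapos x hxM).ne' hax hξ'.ne).2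
      (hatL_smul_le (hx hax) ξ ?_)
    have hcl : ξ ∈ closure {ξ | L x ξ < ⊤} := by
      have hlim : Tendsto (fun s : ℝ => s • ξ) (𝓝[<] 1) (𝓝 ξ) :=
        ((by fun_prop : Continuous fun s : ℝ => s • ξ).tendsto' 1 ξ (one_smul ℝ ξ)).mono_left
          nhdsWithin_le_nhds
      exact mem_closure_of_frequently_of_tendsto (frequently_lt_of_liminf_lt (h := hξ')) hlim
    filter_upwards [Ioo_mem_nhdsLT (one_pos : (0 : ℝ) < 1)] with s hs
    exact hxstar s hs (smul_mem_smul_set hcl)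
end

section
/- Let Ω ⊆ ℝ^d bounded open and m a nonnegative set function on open cubes with m(∅)=0 and ω := limsup_{δ→0} sup_{Q⊆Ω, diam(Q)<δ} m(Q)/|Q| < ∞. Define m⁺_*(x) := limsup_{δ→0} sup{ m^♯(Q)/|Q| : x ∈ Q, diam(Q) < δ } and m⁻_*(x) := liminf_{δ→0} inf{ m(Q)/|Q| : x ∈ Q, diam(Q) < δ }. Then m⁺_*(x) ≤ m⁻_*(x) for almost every x ∈ Ω. -/
open Filter Set Topology MeasureTheory

/-- `Q` is an open axis-parallel cube of `ℝ^d` (with positive side length). -/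
def IsOpenCube {d : ℕ} (Q : Set (Fin d → ℝ)) : Prop :=
  ∃ (c : Fin d → ℝ) (r : ℝ), 0 < r ∧ Q = {y | ∀ i, y i ∈ Set.Ioo (c i) (c i + r)}

/-- `𝒬 ∈ F_δ(E)`: a countable family of open cubes of diameter `< δ` with pairwise
disjoint closures, each meeting `E`, covering `E` up to Lebesgue measure zero. -/
def CubeFam {d : ℕ} (E : Set (Fin d → ℝ)) (δ : ℝ)
    (𝒬 : Set (Set (Fin d → ℝ))) : Prop :=
  𝒬.Countable ∧
  (∀ Q ∈ 𝒬, IsOpenCube Q ∧ Metric.diam Q < δ ∧ (Q ∩ E).Nonempty) ∧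
  𝒬.Pairwise (fun Q Q' => Disjoint (closure Q) (closure Q')) ∧
  volume (E \ ⋃₀ 𝒬) = 0

/-- The Carathéodory-type construction
`m^♯(E) := sup_{δ>0} inf { Σ_i m(Q_i) : {Q_i} ∈ F_δ(E) }` (and `m^♯(∅) = 0`, which holds
automatically since the empty family belongs to `F_δ(∅)`). -/
noncomputable def msharp {d : ℕ} (m : Set (Fin d → ℝ) → ENNReal)
    (E : Set (Fin d → ℝ)) : ENNReal :=
  ⨆ (δ : ℝ) (_ : 0 < δ), ⨅ (𝒬 : Set (Set (Fin d → ℝ))) (_ : CubeFam E δ 𝒬),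
    ∑' Q : 𝒬, m Q

/-- `ω := limsup_{δ→0⁺} sup { m(Q)/|Q| : Q ⊆ Ω an open cube with diam(Q) < δ }`. -/
noncomputable def cubeOmega {d : ℕ} (m : Set (Fin d → ℝ) → ENNReal)
    (Ω : Set (Fin d → ℝ)) : ENNReal :=
  Filter.limsup
    (fun δ : ℝ => ⨆ Q ∈ {Q | IsOpenCube Q ∧ Q ⊆ Ω ∧ Metric.diam Q < δ}, m Q / volume Q)
    (nhdsWithin 0 (Set.Ioi 0))

/-- `m⁺_*(x) := limsup_{δ→0⁺} sup { m^♯(Q)/|Q| : x ∈ Q an open cube, diam(Q) < δ }`. -/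
noncomputable def mPlus {d : ℕ} (m : Set (Fin d → ℝ) → ENNReal)
    (x : Fin d → ℝ) : ENNReal :=
  Filter.limsup
    (fun δ : ℝ =>
      ⨆ Q ∈ {Q | IsOpenCube Q ∧ x ∈ Q ∧ Metric.diam Q < δ}, msharp m Q / volume Q)
    (nhdsWithin 0 (Set.Ioi 0))

/-- `m⁻_*(x) := liminf_{δ→0⁺} inf { m(Q)/|Q| : x ∈ Q an open cube, diam(Q) < δ }`. -/
noncomputable def mMinus {d : ℕ} (m : Set (Fin d → ℝ) → ENNReal)
    (x : Fin d → ℝ) : ENNReal :=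
  Filter.liminf
    (fun δ : ℝ => ⨅ Q ∈ {Q | IsOpenCube Q ∧ x ∈ Q ∧ Metric.diam Q < δ}, m Q / volume Q)
    (nhdsWithin 0 (Set.Ioi 0))

theorem isOpenCube_ball {d : ℕ} (w : Fin d → ℝ) {ρ : ℝ} (hρ : 0 < ρ) :
    IsOpenCube (Metric.ball w ρ) := by
  refine ⟨fun i => w i - ρ, 2 * ρ, by positivity, ?_⟩
  ext y
  rw [ball_pi w hρ]
  simp only [Set.mem_pi, Set.mem_univ, true_imp_iff, Real.ball_eq_Ioo, Set.mem_ofPred_eq]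
  refine forall_congr' fun i => ?_
  rw [show w i - ρ + 2 * ρ = w i + ρ by ring]

/-- In dimension zero the radius of a cube is not determined by its diameter, hence the
auxiliary `ε`. -/
theorem IsOpenCube.exists_eq_ball {d : ℕ} {Q : Set (Fin d → ℝ)} (hQ : IsOpenCube Q) {ε : ℝ}
    (hε : Metric.diam Q < ε) :
    ∃ (w : Fin d → ℝ) (ρ : ℝ), 0 < ρ ∧ ρ < ε ∧ Q = Metric.ball w ρ := by
  obtain ⟨c, r, hr, rfl⟩ := hQ
  have key : {y : Fin d → ℝ | ∀ i, y i ∈ Set.Ioo (c i) (c i + r)}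
      = Metric.ball (fun i => c i + r / 2) (r / 2) := by
    ext y
    rw [ball_pi _ (half_pos hr)]
    simp only [Set.mem_pi, Set.mem_univ, true_imp_iff, Real.ball_eq_Ioo, Set.mem_ofPred_eq]
    refine forall_congr' fun i => ?_
    rw [show c i + r / 2 - r / 2 = c i by ring, show c i + r / 2 + r / 2 = c i + r by ring]
  rw [key] at hε ⊢
  rcases Nat.eq_zero_or_pos d with rfl | hd
  · have hε0 : 0 < ε := Metric.diam_nonneg.trans_lt hε
    refine ⟨fun i => c i + r / 2, ε / 2, half_pos hε0, half_lt_self hε0, ?_⟩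
    ext y
    simp [Subsingleton.elim y (fun i => c i + r / 2), hr, hε0]
  · have : Nonempty (Fin d) := ⟨⟨0, hd⟩⟩
    refine ⟨_, r / 2, half_pos hr, lt_of_le_of_lt ?_ hε, rfl⟩
    refine le_of_forall_lt fun t ht => ?_
    rcases lt_or_ge t 0 with h0 | h0
    · exact h0.trans_le Metric.diam_nonneg
    have hs : t < (t + r / 2) / 2 := by linarith
    refine hs.trans_le ?_
    have hmem : (fun i => c i + r / 2 + (t + r / 2) / 2) ∈
        Metric.ball (fun i => c i + r / 2) (r / 2) := by
      rw [Metric.mem_ball, dist_pi_lt_iff (half_pos hr)]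
      intro i
      rw [Real.dist_eq, add_sub_cancel_left, abs_of_nonneg (by linarith)]
      linarith
    have h := Metric.dist_le_diam_of_mem Metric.isBounded_ball hmem
      (Metric.mem_ball_self (half_pos hr))
    refine le_trans ?_ ((dist_le_pi_dist _ _ ⟨0, hd⟩).trans h)
    rw [Real.dist_eq, add_sub_cancel_left]
    exact le_abs_self _

theorem IsOpenCube.exists_ball {d : ℕ} {Q : Set (Fin d → ℝ)} (hQ : IsOpenCube Q) :
    ∃ (w : Fin d → ℝ) (ρ : ℝ), 0 < ρ ∧ Q = Metric.ball w ρ :=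
  let ⟨w, ρ, hρ, _, h⟩ := hQ.exists_eq_ball (lt_add_one _)
  ⟨w, ρ, hρ, h⟩

theorem IsOpenCube.isOpen {d : ℕ} {Q : Set (Fin d → ℝ)} (hQ : IsOpenCube Q) : IsOpen Q := by
  obtain ⟨w, ρ, -, rfl⟩ := hQ.exists_ball
  exact Metric.isOpen_ball

theorem IsOpenCube.isBounded {d : ℕ} {Q : Set (Fin d → ℝ)} (hQ : IsOpenCube Q) :
    Bornology.IsBounded Q := by
  obtain ⟨w, ρ, -, rfl⟩ := hQ.exists_ball
  exact Metric.isBounded_ball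

theorem IsOpenCube.nonempty {d : ℕ} {Q : Set (Fin d → ℝ)} (hQ : IsOpenCube Q) : Q.Nonempty := by
  obtain ⟨w, ρ, hρ, rfl⟩ := hQ.exists_ball
  exact ⟨w, Metric.mem_ball_self hρ⟩

theorem IsOpenCube.volume_pos {d : ℕ} {Q : Set (Fin d → ℝ)} (hQ : IsOpenCube Q) :
    0 < volume Q :=
  hQ.isOpen.measure_pos volume hQ.nonempty

theorem IsOpenCube.volume_ne_top {d : ℕ} {Q : Set (Fin d → ℝ)} (hQ : IsOpenCube Q) :
    volume Q ≠ ⊤ :=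
  hQ.isBounded.measure_lt_top.ne

theorem volume_pi_closedBall_diff_ball {d : ℕ} (w : Fin d → ℝ) {ρ : ℝ} (hρ : 0 < ρ) :
    volume (Metric.closedBall w ρ \ Metric.ball w ρ) = 0 := by
  rw [measure_sdiff Metric.ball_subset_closedBall measurableSet_ball.nullMeasurableSet
      Metric.isBounded_ball.measure_lt_top.ne, Real.volume_pi_ball w hρ,
    Real.volume_pi_closedBall w hρ.le, tsub_self]

theorem IsOpenCube.volume_closure_diff {d : ℕ} {Q : Set (Fin d → ℝ)} (hQ : IsOpenCube Q) :
    volume (closure Q \ Q) = 0 := by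
  obtain ⟨w, ρ, hρ, rfl⟩ := hQ.exists_ball
  rw [closure_ball w hρ.ne']
  exact volume_pi_closedBall_diff_ball w hρ

theorem IsOpenCube.closure_subset_closedBall {d : ℕ} {Q : Set (Fin d → ℝ)} (hQ : IsOpenCube Q)
    {x : Fin d → ℝ} (hx : x ∈ Q) : closure Q ⊆ Metric.closedBall x (Metric.diam Q) :=
  closure_minimal (fun _ hy => Metric.dist_le_diam_of_mem hQ.isBounded hy hx)
    Metric.isClosed_closedBall

theorem IsOpenCube.closure_subset_ball {d : ℕ} {Q : Set (Fin d → ℝ)} (hQ : IsOpenCube Q)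
    {x : Fin d → ℝ} (hx : x ∈ Q) {ε : ℝ} (hε : Metric.diam Q < ε) :
    closure Q ⊆ Metric.ball x ε :=
  (hQ.closure_subset_closedBall hx).trans (Metric.closedBall_subset_ball hε)

theorem IsOpenCube.volume_closedBall_le {d : ℕ} {Q : Set (Fin d → ℝ)} (hQ : IsOpenCube Q)
    (x : Fin d → ℝ) :
    volume (Metric.closedBall x (3 * Metric.diam Q)) ≤ ((6 ^ d : NNReal) : ENNReal) * volume Q := by
  obtain ⟨w, ρ, hρ, rfl⟩ := hQ.exists_ball
  have hdiam : Metric.diam (Metric.ball w ρ) ≤ 2 * ρ := Metric.diam_ball hρ.le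
  have h6 : ((6 ^ d : NNReal) : ENNReal) = ENNReal.ofReal (6 ^ d) := by
    rw [ENNReal.ofReal_pow (by norm_num)]
    norm_num
  rw [Real.volume_pi_closedBall x (by positivity), Real.volume_pi_ball w hρ, Fintype.card_fin, h6,
    ← ENNReal.ofReal_mul (by positivity), ← mul_pow]
  refine ENNReal.ofReal_le_ofReal (pow_le_pow_left₀ (by positivity) (by linarith) d)

/-- Vitali covering theorem for open cubes with pairwise disjoint closures. -/
theorem exists_cubes_covering_ae {d : ℕ} (s : Set (Fin d → ℝ)) (P : Set (Fin d → ℝ) → Prop)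
    (h : ∀ x ∈ s, ∀ ε > 0, ∃ Q, IsOpenCube Q ∧ x ∈ Q ∧ Metric.diam Q < ε ∧ P Q) :
    ∃ 𝒬 : Set (Set (Fin d → ℝ)), 𝒬.Countable ∧ (∀ Q ∈ 𝒬, IsOpenCube Q ∧ P Q) ∧
      𝒬.Pairwise (fun Q Q' => Disjoint (closure Q) (closure Q')) ∧ volume (s \ ⋃₀ 𝒬) = 0 := by
  obtain ⟨u, hut, huc, hud, hus⟩ := Vitali.exists_disjoint_covering_ae volume s
    {p : (Fin d → ℝ) × Set (Fin d → ℝ) | IsOpenCube p.2 ∧ p.1 ∈ p.2 ∧ P p.2} (6 ^ d)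
    (fun p => Metric.diam p.2) Prod.fst (fun p => closure p.2)
    (fun p hp => hp.1.closure_subset_closedBall hp.2.1)
    (fun p hp => (hp.1.volume_closedBall_le p.1).trans (by gcongr; exact subset_closure))
    (fun p hp => hp.1.nonempty.mono (interior_maximal subset_closure hp.1.isOpen))
    (fun _ _ => isClosed_closure)
    (fun x hx ε hε => by
      obtain ⟨Q, hQ, hxQ, hd, hP⟩ := h x hx ε hε
      exact ⟨(x, Q), ⟨hQ, hxQ, hP⟩, hd.le, rfl⟩)
  refine ⟨Prod.snd '' u, huc.image _, ?_, ?_, ?_⟩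
  · rintro _ ⟨p, hp, rfl⟩
    exact ⟨(hut hp).1, (hut hp).2.2⟩
  · rintro _ ⟨p, hp, rfl⟩ _ ⟨q, hq, rfl⟩ hne
    exact hud hp hq fun hpq => hne (by rw [hpq])
  · refine measure_mono_null (t := (s \ ⋃ p ∈ u, closure p.2) ∪ ⋃ p ∈ u, (closure p.2 \ p.2))
      (fun x hx => ?_) (measure_union_null hus
        ((measure_biUnion_null_iff huc).2 fun p hp => (hut hp).1.volume_closure_diff))
    by_cases hxu : x ∈ ⋃ p ∈ u, closure p.2
    · obtain ⟨p, hp, hxp⟩ := mem_iUnion₂.1 hxu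
      exact Or.inr (mem_iUnion₂.2 ⟨p, hp, hxp, fun hx' => hx.2 ⟨p.2, ⟨p, hp, rfl⟩, hx'⟩⟩)
    · exact Or.inl ⟨hx.1, hxu⟩

theorem volume_sUnion_cubes {d : ℕ} {𝒬 : Set (Set (Fin d → ℝ))} (hc : 𝒬.Countable)
    (hcube : ∀ Q ∈ 𝒬, IsOpenCube Q)
    (hd : 𝒬.Pairwise (fun Q Q' => Disjoint (closure Q) (closure Q'))) :
    volume (⋃₀ 𝒬) = ∑' Q : 𝒬, volume (Q : Set (Fin d → ℝ)) :=
  measure_sUnion hc (fun _ hQ _ hQ' hne => (hd hQ hQ' hne).mono subset_closure subset_closure)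
    fun Q hQ => (hcube Q hQ).isOpen.measurableSet

theorem tsum_le_mul_volume_sUnion {d : ℕ} {m : Set (Fin d → ℝ) → ENNReal} {b : ENNReal}
    {𝒬 : Set (Set (Fin d → ℝ))} (hc : 𝒬.Countable) (hcube : ∀ Q ∈ 𝒬, IsOpenCube Q)
    (hd : 𝒬.Pairwise (fun Q Q' => Disjoint (closure Q) (closure Q')))
    (hb : ∀ Q ∈ 𝒬, m Q ≤ b * volume Q) :
    ∑' Q : 𝒬, m Q ≤ b * volume (⋃₀ 𝒬) := by
  rw [volume_sUnion_cubes hc hcube hd, ← ENNReal.tsum_mul_left]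
  exact ENNReal.tsum_le_tsum fun Q => hb Q Q.2

/-- If `m` has upper density at most `M` on small cubes inside `Q`, and density at most `b` on
arbitrarily small cubes around the points of `s ⊆ Q`, then `m^♯(Q) ≤ b |Q| + M (|Q| - |s|)`. -/
theorem msharp_le_of_fine_cover {d : ℕ} {m : Set (Fin d → ℝ) → ENNReal} {Q : Set (Fin d → ℝ)}
    (hQ : IsOpenCube Q) {b M : ENNReal} {δ₀ : ℝ} (hδ₀ : 0 < δ₀)
    (hM : ∀ Q', IsOpenCube Q' → Q' ⊆ Q → Metric.diam Q' < δ₀ → m Q' ≤ M * volume Q')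
    {s : Set (Fin d → ℝ)} (hsQ : s ⊆ Q)
    (hs : ∀ x ∈ s, ∀ ε > 0, ∃ Q', IsOpenCube Q' ∧ x ∈ Q' ∧ Metric.diam Q' < ε ∧
      m Q' ≤ b * volume Q')
    {v : ENNReal} (hv : v < volume s) :
    msharp m Q ≤ b * volume Q + M * (volume Q - v) := by
  refine iSup₂_le fun δ hδ => ?_
  obtain ⟨𝒢, h𝒢c, h𝒢, h𝒢d, h𝒢s⟩ := exists_cubes_covering_ae s
    (fun Q' => Metric.diam Q' < δ ∧ Q' ⊆ Q ∧ m Q' ≤ b * volume Q') (by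
      intro x hx ε hε
      obtain ⟨η, hη, hηQ⟩ := Metric.isOpen_iff.1 hQ.isOpen x (hsQ hx)
      obtain ⟨Q', hQ', hxQ', hdiam, hb⟩ := hs x hx (min ε (min η δ)) (by positivity)
      simp only [lt_min_iff] at hdiam
      exact ⟨Q', hQ', hxQ', hdiam.1, hdiam.2.2, subset_closure.trans
        ((hQ'.closure_subset_ball hxQ' hdiam.2.1).trans hηQ), hb⟩)
  have hv𝒢 : v < volume (⋃₀ 𝒢) := hv.trans_le (measure_mono_ae (ae_le_set.2 h𝒢s))
  rw [volume_sUnion_cubes h𝒢c (fun Q' h => (h𝒢 Q' h).1) h𝒢d, ENNReal.tsum_eq_iSup_sum,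
    lt_iSup_iff] at hv𝒢
  obtain ⟨F, hF⟩ := hv𝒢
  set ℱ : Set (Set (Fin d → ℝ)) := Subtype.val '' (F : Set 𝒢) with hℱ
  have hℱ𝒢 : ℱ ⊆ 𝒢 := by
    rintro _ ⟨q, -, rfl⟩
    exact q.2
  have hℱfin : ℱ.Finite := F.finite_toSet.image _
  have hℱd := h𝒢d.mono hℱ𝒢
  have hℱcube : ∀ Q' ∈ ℱ, IsOpenCube Q' := fun Q' h => (h𝒢 Q' (hℱ𝒢 h)).1
  have hℱv : v < volume (⋃₀ ℱ) := by
    rw [volume_sUnion_cubes hℱfin.countable hℱcube hℱd, hℱ,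
      tsum_image (fun q : Set (Fin d → ℝ) => volume q) Subtype.val_injective.injOn]
    rwa [Finset.tsum_subtype' F fun q : 𝒢 => volume (q : Set (Fin d → ℝ))]
  have hℱQ : ⋃₀ ℱ ⊆ Q := sUnion_subset fun Q' h => (h𝒢 Q' (hℱ𝒢 h)).2.2.1
  have hℱmeas : MeasurableSet (⋃₀ ℱ) :=
    (isOpen_sUnion fun Q' h => (hℱcube Q' h).isOpen).measurableSet
  set U : Set (Fin d → ℝ) := Q \ ⋃ Q' ∈ ℱ, closure Q' with hU
  have hUopen : IsOpen U :=
    hQ.isOpen.sdiff (hℱfin.isClosed_biUnion fun _ _ => isClosed_closure)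
  obtain ⟨ℬ, hℬc, hℬ, hℬd, hℬU⟩ := exists_cubes_covering_ae U
    (fun Q' => Metric.diam Q' < δ ∧ closure Q' ⊆ U ∧ m Q' ≤ M * volume Q') (by
      intro x hx ε hε
      obtain ⟨η, hη, hηU⟩ := Metric.isOpen_iff.1 hUopen x hx
      set τ := min (min ε η) (min δ δ₀) with hτ
      have hτ0 : 0 < τ := by positivity
      have hcube := isOpenCube_ball x (show 0 < τ / 3 by positivity)
      have hxc : x ∈ Metric.ball x (τ / 3) := Metric.mem_ball_self (by positivity)
      have hdiam : Metric.diam (Metric.ball x (τ / 3)) < τ :=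
        (Metric.diam_ball (by positivity)).trans_lt (by linarith)
      have hdiam' := hdiam
      rw [hτ] at hdiam'
      simp only [lt_min_iff] at hdiam'
      obtain ⟨⟨h1, h2⟩, h3, h4⟩ := hdiam'
      have hcU := (hcube.closure_subset_ball hxc h2).trans hηU
      exact ⟨_, hcube, hxc, h1, h3, hcU,
        hM _ hcube (subset_closure.trans (hcU.trans sdiff_subset)) h4⟩)
  have hℬcube : ∀ Q' ∈ ℬ, IsOpenCube Q' := fun Q' h => (hℬ Q' h).1
  have hcross : ∀ Q₁ ∈ ℱ, ∀ Q₂ ∈ ℬ, Disjoint (closure Q₁) (closure Q₂) := fun Q₁ h₁ Q₂ h₂ =>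
    Set.disjoint_left.2 fun y hy₁ hy₂ => ((hℬ Q₂ h₂).2.2.1 hy₂).2 (mem_iUnion₂.2 ⟨Q₁, h₁, hy₁⟩)
  have hfam : CubeFam Q δ (ℱ ∪ ℬ) := by
    refine ⟨hℱfin.countable.union hℬc, ?_, ?_, ?_⟩
    · rintro Q' (h | h)
      · have hg := h𝒢 Q' (hℱ𝒢 h)
        exact ⟨hg.1, hg.2.1, by rw [inter_eq_left.2 hg.2.2.1]; exact hg.1.nonempty⟩
      · have hg := hℬ Q' h
        refine ⟨hg.1, hg.2.1, ?_⟩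
        rw [inter_eq_left.2 (subset_closure.trans (hg.2.2.1.trans sdiff_subset))]
        exact hg.1.nonempty
    · rintro Q₁ (h₁ | h₁) Q₂ (h₂ | h₂) hne
      · exact hℱd h₁ h₂ hne
      · exact hcross Q₁ h₁ Q₂ h₂
      · exact (hcross Q₂ h₂ Q₁ h₁).symm
      · exact hℬd h₁ h₂ hne
    · refine measure_mono_null (t := (U \ ⋃₀ ℬ) ∪ ⋃ Q' ∈ ℱ, (closure Q' \ Q')) (fun x hx => ?_)
        (measure_union_null hℬU ((measure_biUnion_null_iff hℱfin.countable).2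
          fun Q' h => (hℱcube Q' h).volume_closure_diff))
      rw [sUnion_union] at hx
      by_cases hxF : x ∈ ⋃ Q' ∈ ℱ, closure Q'
      · obtain ⟨Q', h, hxQ'⟩ := mem_iUnion₂.1 hxF
        exact Or.inr (mem_iUnion₂.2 ⟨Q', h, hxQ', fun h' => hx.2 (Or.inl ⟨Q', h, h'⟩)⟩)
      · exact Or.inl ⟨⟨hx.1, hxF⟩, fun h' => hx.2 (Or.inr h')⟩
  refine iInf₂_le_of_le _ hfam ((ENNReal.tsum_union_le m ℱ ℬ).trans (add_le_add ?_ ?_))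
  · refine (tsum_le_mul_volume_sUnion hℱfin.countable hℱcube hℱd
      fun Q' h => (h𝒢 Q' (hℱ𝒢 h)).2.2.2).trans ?_
    gcongr
  · refine (tsum_le_mul_volume_sUnion hℬc hℬcube hℬd fun Q' h => (hℬ Q' h).2.2.2).trans ?_
    gcongr
    have hsub : ⋃₀ ℬ ⊆ Q \ ⋃₀ ℱ := sUnion_subset fun Q' h y hy => by
      have hyU := (hℬ Q' h).2.2.1 (subset_closure hy)
      exact ⟨hyU.1, fun ⟨Q₁, h₁, hy₁⟩ => hyU.2 (mem_iUnion₂.2 ⟨Q₁, h₁, subset_closure hy₁⟩)⟩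
    calc volume (⋃₀ ℬ) ≤ volume (Q \ ⋃₀ ℱ) := measure_mono hsub
      _ = volume Q - volume (⋃₀ ℱ) := measure_sdiff hℱQ hℱmeas.nullMeasurableSet
          ((measure_mono hℱQ).trans_lt hQ.volume_ne_top.lt_top).ne
      _ ≤ volume Q - v := tsub_le_tsub_left hℱv.le _

theorem exists_cube_of_mMinus_lt {d : ℕ} {m : Set (Fin d → ℝ) → ENNReal} {x : Fin d → ℝ}
    {b : ENNReal} (hb : mMinus m x < b) {ε : ℝ} (hε : 0 < ε) :
    ∃ Q, IsOpenCube Q ∧ x ∈ Q ∧ Metric.diam Q < ε ∧ m Q ≤ b * volume Q := by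
  have hfreq := frequently_lt_of_liminf_lt (h := hb)
  obtain ⟨δ, hδ, hδε⟩ := (hfreq.and_eventually
    (mem_nhdsWithin_of_mem_nhds (Iio_mem_nhds hε))).exists
  simp only [iInf_lt_iff] at hδ
  obtain ⟨Q, ⟨hQ, hxQ, hdiam⟩, hlt⟩ := hδ
  exact ⟨Q, hQ, hxQ, hdiam.trans hδε,
    (ENNReal.div_le_iff hQ.volume_pos.ne' hQ.volume_ne_top).1 hlt.le⟩

theorem exists_bound_of_cubeOmega_lt_top {d : ℕ} {m : Set (Fin d → ℝ) → ENNReal}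
    {Ω : Set (Fin d → ℝ)} (hω : cubeOmega m Ω < ⊤) :
    ∃ M : NNReal, ∃ δ₀ > 0, ∀ Q, IsOpenCube Q → Q ⊆ Ω → Metric.diam Q < δ₀ →
      m Q ≤ M * volume Q := by
  obtain ⟨M, hM, -⟩ := ENNReal.lt_iff_exists_nnreal_btwn.1 hω
  obtain ⟨δ, hδ, hδ0⟩ := ((eventually_lt_of_limsup_lt hM).and self_mem_nhdsWithin).exists
  refine ⟨M, δ, hδ0, fun Q hQ hQΩ hdiam => ?_⟩
  rw [← ENNReal.div_le_iff hQ.volume_pos.ne' hQ.volume_ne_top]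
  exact (le_iSup₂ (f := fun Q (_ : Q ∈ {Q | IsOpenCube Q ∧ Q ⊆ Ω ∧ Metric.diam Q < δ}) =>
    m Q / volume Q) Q ⟨hQ, hQΩ, hdiam⟩).trans hδ.le

/-- Lebesgue density theorem along cubes containing, but not necessarily centred at, a point of an
arbitrary set. -/
theorem ae_exists_forall_cube_mul_volume_lt {d : ℕ} (S : Set (Fin d → ℝ)) :
    ∀ᵐ x : Fin d → ℝ, x ∈ S → ∀ θ < (1 : ENNReal), ∃ δ > 0, ∀ Q, IsOpenCube Q → x ∈ Q →
      Metric.diam Q < δ → θ * volume Q < volume (S ∩ Q) := by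
  refine ae_imp_of_ae_restrict ?_
  filter_upwards [IsUnifLocDoublingMeasure.ae_tendsto_measure_inter_div volume S 1] with x hx θ hθ
  have hlim := hx (l := 𝓟 {p : (Fin d → ℝ) × ℝ | x ∈ Metric.closedBall p.1 p.2} ⊓
      comap Prod.snd (𝓝[>] 0)) Prod.fst Prod.snd (tendsto_comap.mono_left inf_le_right)
    (mem_inf_of_left fun p hp => by simpa using hp)
  have hev := hlim.eventually (lt_mem_nhds hθ)
  rw [inf_comm, eventually_inf_principal, eventually_comap,
    eventually_nhdsWithin_iff, Metric.eventually_nhds_iff] at hev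
  obtain ⟨δ, hδ, H⟩ := hev
  refine ⟨δ, hδ, fun Q hQ hxQ hdiam => ?_⟩
  obtain ⟨w, ρ, hρ, hρδ, rfl⟩ := hQ.exists_eq_ball hdiam
  have h := H (y := ρ) (by simpa [abs_of_pos hρ] using hρδ) hρ (w, ρ) rfl
    (Metric.ball_subset_closedBall hxQ)
  have hae : (Metric.closedBall w ρ : Set (Fin d → ℝ)) =ᵐ[volume] Metric.ball w ρ :=
    ae_eq_set.2 ⟨volume_pi_closedBall_diff_ball w hρ,
      by rw [sdiff_eq_empty.2 Metric.ball_subset_closedBall, measure_empty]⟩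
  simp only at h
  rw [measure_congr hae, measure_congr ((ae_eq_refl S).inter hae)] at h
  exact (ENNReal.lt_div_iff_mul_lt (Or.inl hQ.volume_pos.ne') (Or.inl hQ.volume_ne_top)).1 h

theorem ae_mPlus_le_of_mMinus_lt {d : ℕ} {Ω : Set (Fin d → ℝ)} (hΩ : IsOpen Ω)
    {m : Set (Fin d → ℝ) → ENNReal} (hω : cubeOmega m Ω < ⊤) (b : ENNReal) :
    ∀ᵐ x : Fin d → ℝ, x ∈ Ω → mMinus m x < b → mPlus m x ≤ b := by
  obtain ⟨M, δ₀, hδ₀, hM⟩ := exists_bound_of_cubeOmega_lt_top hω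
  filter_upwards [ae_exists_forall_cube_mul_volume_lt {x | mMinus m x < b}] with x hx hxΩ hxb
  obtain ⟨η, hη, hηΩ⟩ := Metric.isOpen_iff.1 hΩ x hxΩ
  have hbound : ∀ θ < (1 : ENNReal), mPlus m x ≤ b + M * (1 - θ) := by
    intro θ hθ
    obtain ⟨δ, hδ, hdens⟩ := hx hxb θ hθ
    refine limsup_le_of_le (h := ?_)
    filter_upwards [mem_nhdsWithin_of_mem_nhds (Iio_mem_nhds (lt_min hη hδ))] with t ht
    refine iSup₂_le fun Q ⟨hQ, hxQ, hdiam⟩ => ?_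
    obtain ⟨hQη, hQδ⟩ := lt_min_iff.1 (hdiam.trans ht)
    have hQΩ : Q ⊆ Ω := subset_closure.trans ((hQ.closure_subset_ball hxQ hQη).trans hηΩ)
    rw [ENNReal.div_le_iff hQ.volume_pos.ne' hQ.volume_ne_top]
    refine (msharp_le_of_fine_cover hQ hδ₀ (fun Q' hQ' hsub => hM Q' hQ' (hsub.trans hQΩ))
      inter_subset_right (fun y hy ε hε => exists_cube_of_mMinus_lt hy.1 hε)
      (hdens Q hQ hxQ hQδ)).trans_eq ?_
    rw [add_mul, mul_assoc, ENNReal.sub_mul fun _ _ => hQ.volume_ne_top, one_mul]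
  have hlim : Tendsto (fun θ : ENNReal => b + M * (1 - θ)) (𝓝[<] 1) (𝓝 (b + M * (1 - 1))) := by
    refine Tendsto.mono_left ?_ nhdsWithin_le_nhds
    exact tendsto_const_nhds.add (ENNReal.Tendsto.const_mul
      (ENNReal.Tendsto.sub tendsto_const_nhds tendsto_id (Or.inl ENNReal.one_ne_top))
      (Or.inr ENNReal.coe_ne_top))
  rw [tsub_self, mul_zero, add_zero] at hlim
  have : (𝓝[<] (1 : ENNReal)).NeBot := nhdsLT_neBot_of_exists_lt ⟨0, zero_lt_one⟩
  exact ge_of_tendsto hlim (eventually_nhdsWithin_of_forall hbound)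

/-- (Lemma 7.7.) If `ω < ∞` then `m⁺_*(x) ≤ m⁻_*(x)` for almost every `x ∈ Ω`. -/
theorem stmt18 {d : ℕ} (Ω : Set (Fin d → ℝ))
    (hΩopen : IsOpen Ω) (hΩbd : Bornology.IsBounded Ω)
    (m : Set (Fin d → ℝ) → ENNReal) (hm0 : m ∅ = 0)
    (hω : cubeOmega m Ω < ⊤) :
    ∀ᵐ x ∂(volume.restrict Ω), mPlus m x ≤ mMinus m x := by
  have hae : ∀ᵐ x : Fin d → ℝ, ∀ q : ℚ, x ∈ Ω → mMinus m x < ENNReal.ofReal q →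
      mPlus m x ≤ ENNReal.ofReal q :=
    ae_all_iff.2 fun q => ae_mPlus_le_of_mMinus_lt hΩopen hω _
  rw [ae_restrict_iff' hΩopen.measurableSet]
  filter_upwards [hae] with x hx hxΩ
  by_contra! hlt
  obtain ⟨q, -, hq₁, hq₂⟩ := ENNReal.lt_iff_exists_rat_btwn.1 hlt
  exact (hx q hxΩ hq₁).not_gt hq₂
end
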